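/- arXiv:math/0607512 — 3 statements merged into one kernel-verified Lean document; each statement's English description precedes it below -/
import Mathlib

section
/- The generalized Petersen graph GP(7,2) is a cubic graph with 14 vertices, it has a Hamiltonian cycle, and γ(GP(7,2)) = 5 = ⌈14/3⌉. -/
open SimpleGraph

/-- `D` is a dominating set of `G`. -/
def IsDomSet {V : Type*} (G : SimpleGraph V) (D : Set V) : Prop :=
  ∀ v : V, v ∉ D → ∃ u ∈ D, G.Adj u v

/-- The domination number of `G`. -/
noncomputable def domNum {V : Type*} (G : SimpleGraph V) : ℕ :=
  sInf {n : ℕ | ∃ D : Set V, IsDomSet G D ∧ D.ncard = n}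

/-- A graph is cubic if every vertex has degree three. -/
def IsCubic {V : Type*} (G : SimpleGraph V) : Prop :=
  ∀ v : V, Nat.card (G.neighborSet v) = 3

/-- The generalized Petersen graph `GP(7,2)`: vertices `u_i = Sum.inl i`, `w_i = Sum.inr i`
for `i : ZMod 7`, and edges `u_i u_{i+1}`, `u_i w_i`, `w_i w_{i+2}`. -/
def GP72 : SimpleGraph (ZMod 7 ⊕ ZMod 7) :=
  SimpleGraph.fromRel (fun a b =>
    (∃ i : ZMod 7, a = Sum.inl i ∧ b = Sum.inl (i + 1)) ∨
    (∃ i : ZMod 7, a = Sum.inl i ∧ b = Sum.inr i) ∨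
    (∃ i : ZMod 7, a = Sum.inr i ∧ b = Sum.inr (i + 2)))

instance GP72_decAdj : DecidableRel GP72.Adj := fun a b => by
  unfold GP72
  rw [SimpleGraph.fromRel_adj]
  infer_instance

/-- Index of a vertex among the numbers below 14. -/
def vIdx : ZMod 7 ⊕ ZMod 7 → ℕ
  | Sum.inl i => i.val
  | Sum.inr i => 7 + i.val

/-- Closed neighbourhoods as bit masks. -/
def maskList : List ℕ :=
  [195, 263, 526, 1052, 2104, 4208, 8289, 4737, 9474, 2692, 5384, 10768, 5280, 10560]

def vMask (v : ZMod 7 ⊕ ZMod 7) : ℕ := maskList.getD (vIdx v) 0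

set_option maxRecDepth 100000 in
theorem vMask_mem : ∀ v, vMask v ∈ maskList := by decide

set_option maxRecDepth 100000 in
theorem vMask_lt : ∀ v, vMask v < 2 ^ 14 := by decide

set_option maxRecDepth 100000 in
theorem vIdx_surj : ∀ i < 14, ∃ v, vIdx v = i := by decide

set_option maxRecDepth 100000 in
theorem cov_bit : ∀ a v, (a = v ∨ GP72.Adj a v) → (vMask a).testBit (vIdx v) = true := by
  decide +kernel

theorem mask_check : (maskList.all fun a => maskList.all fun b => maskList.all fun c =>
    maskList.all fun d => !(Nat.beq (a ||| b ||| c ||| d) 16383)) = true := by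
  decide +kernel

theorem no_four (a b c d : ZMod 7 ⊕ ZMod 7) :
    ¬ ∀ v, ∃ x, (x = a ∨ x = b ∨ x = c ∨ x = d) ∧ (x = v ∨ GP72.Adj x v) := by
  intro h
  have hc := mask_check
  simp only [List.all_eq_true] at hc
  have := hc _ (vMask_mem a) _ (vMask_mem b) _ (vMask_mem c) _ (vMask_mem d)
  have key : vMask a ||| vMask b ||| vMask c ||| vMask d = 2 ^ 14 - 1 := by
    apply Nat.eq_of_testBit_eq
    intro i
    rw [Nat.testBit_two_pow_sub_one]
    by_cases hi : i < 14
    · obtain ⟨v, rfl⟩ := vIdx_surj i hi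
      obtain ⟨x, hx, hxv⟩ := h v
      have hb := cov_bit x v hxv
      rcases hx with rfl | rfl | rfl | rfl <;> simp [Nat.testBit_or, hb, hi]
    · have hlt : vMask a ||| vMask b ||| vMask c ||| vMask d < 2 ^ 14 :=
        Nat.or_lt_two_pow (Nat.or_lt_two_pow (Nat.or_lt_two_pow (vMask_lt a) (vMask_lt b))
          (vMask_lt c)) (vMask_lt d)
      rw [Nat.testBit_lt_two_pow (lt_of_lt_of_le hlt (Nat.pow_le_pow_right (by norm_num)
        (not_lt.mp hi)))]
      simp [hi]
  rw [key] at this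
  revert this
  decide

theorem five_le_of_dom (D : Set (ZMod 7 ⊕ ZMod 7)) (hD : IsDomSet GP72 D) : 5 ≤ D.ncard := by
  classical
  by_contra hlt
  rw [Set.ncard_eq_toFinset_card'] at hlt
  obtain ⟨T, hDT, -, hT⟩ := Finset.exists_subsuperset_card_eq
    (Finset.subset_univ D.toFinset) (n := 4) (by omega) (by decide)
  rw [← Finset.length_toList, List.length_eq_four] at hT
  obtain ⟨a, b, c, d, hl⟩ := hT
  have hmem : ∀ x ∈ D, x = a ∨ x = b ∨ x = c ∨ x = d := by
    intro x hx
    have : x ∈ T.toList := Finset.mem_toList.mpr (hDT (Set.mem_toFinset.mpr hx))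
    simpa [hl] using this
  apply no_four a b c d
  intro v
  by_cases hv : v ∈ D
  · exact ⟨v, hmem v hv, Or.inl rfl⟩
  · obtain ⟨u, hu, huv⟩ := hD v hv
    exact ⟨u, hmem u hu, Or.inr huv⟩

set_option maxRecDepth 100000 in
theorem dom_five : IsDomSet GP72
    (({Sum.inl 0, Sum.inl 1, Sum.inl 2, Sum.inr 4, Sum.inr 5} :
      Finset (ZMod 7 ⊕ ZMod 7)) : Set (ZMod 7 ⊕ ZMod 7)) := by
  have : ∀ v, v ∉ ({Sum.inl 0, Sum.inl 1, Sum.inl 2, Sum.inr 4, Sum.inr 5} :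
      Finset (ZMod 7 ⊕ ZMod 7)) → ∃ u ∈ ({Sum.inl 0, Sum.inl 1, Sum.inl 2, Sum.inr 4, Sum.inr 5} :
      Finset (ZMod 7 ⊕ ZMod 7)), GP72.Adj u v := by decide +kernel
  exact_mod_cast this

/-- A Hamiltonian cycle. -/
def hamWalk : GP72.Walk (Sum.inl 0) (Sum.inl 0) :=
  .cons (show GP72.Adj (Sum.inl 0) (Sum.inl 1) by decide +kernel) <|
  .cons (show GP72.Adj (Sum.inl 1) (Sum.inl 2) by decide +kernel) <|
  .cons (show GP72.Adj (Sum.inl 2) (Sum.inr 2) by decide +kernel) <|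
  .cons (show GP72.Adj (Sum.inr 2) (Sum.inr 4) by decide +kernel) <|
  .cons (show GP72.Adj (Sum.inr 4) (Sum.inl 4) by decide +kernel) <|
  .cons (show GP72.Adj (Sum.inl 4) (Sum.inl 3) by decide +kernel) <|
  .cons (show GP72.Adj (Sum.inl 3) (Sum.inr 3) by decide +kernel) <|
  .cons (show GP72.Adj (Sum.inr 3) (Sum.inr 1) by decide +kernel) <|
  .cons (show GP72.Adj (Sum.inr 1) (Sum.inr 6) by decide +kernel) <|
  .cons (show GP72.Adj (Sum.inr 6) (Sum.inl 6) by decide +kernel) <|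
  .cons (show GP72.Adj (Sum.inl 6) (Sum.inl 5) by decide +kernel) <|
  .cons (show GP72.Adj (Sum.inl 5) (Sum.inr 5) by decide +kernel) <|
  .cons (show GP72.Adj (Sum.inr 5) (Sum.inr 0) by decide +kernel) <|
  .cons (show GP72.Adj (Sum.inr 0) (Sum.inl 0) by decide +kernel) <|
  .nil

theorem hamWalk_isHam : hamWalk.IsHamiltonianCycle := by
  rw [SimpleGraph.Walk.isHamiltonianCycle_iff_isCycle_and_support_count_tail_eq_one,
    SimpleGraph.Walk.isCycle_def, SimpleGraph.Walk.isTrail_def]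
  refine ⟨⟨?_, ?_, ?_⟩, ?_⟩
  · decide +kernel
  · intro h
    cases h
  · decide +kernel
  · decide +kernel

theorem GP72_cubic : IsCubic GP72 := by
  intro v
  rw [Nat.card_eq_fintype_card, SimpleGraph.card_neighborSet_eq_degree]
  revert v
  decide +kernel

/-- `GP(7,2)` is a cubic graph with 14 vertices, it has a Hamiltonian cycle,
and `γ(GP(7,2)) = 5 = ⌈14/3⌉`. -/
theorem stmt_15 :
    IsCubic GP72 ∧
    Fintype.card (ZMod 7 ⊕ ZMod 7) = 14 ∧
    (∃ (v : ZMod 7 ⊕ ZMod 7) (p : GP72.Walk v v), p.IsHamiltonianCycle) ∧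
    domNum GP72 = 5 ∧
    (5 : ℕ) = ⌈(14 : ℚ) / 3⌉₊ := by
  refine ⟨GP72_cubic, by decide, ⟨_, hamWalk, hamWalk_isHam⟩, ?_, ?_⟩
  · apply le_antisymm
    · exact Nat.sInf_le ⟨_, dom_five, by rw [Set.ncard_coe_finset]; decide⟩
    · refine le_csInf ⟨_, _, dom_five, rfl⟩ ?_
      rintro n ⟨D, hD, rfl⟩
      exact five_le_of_dom D hD
  · symm
    rw [Nat.ceil_eq_iff (by norm_num)]
    norm_num
end

section
/- For every integer k ≥ 1, the graph M²_k is a cubic graph with 6k + 2 vertices, it has a Hamiltonian cycle, and γ(M²_k) = 2k + 1 = ⌈(6k+2)/3⌉. -/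
open SimpleGraph

/-- The graph `M²_k`: vertices `x_i = Sum.inl i`, `y_i = Sum.inr i` for `0 ≤ i ≤ 3k`; edges:
the two `(3k+1)`-cycles on the `x`'s and on the `y`'s, the edge `x_0 y_0`, the edges `x_i y_i`
for `1 ≤ i ≤ 3k−2` with `i ≡ 1 (mod 3)`, and the edges `x_i y_{i+1}`, `x_{i+1} y_i` for
`2 ≤ i ≤ 3k−1` with `i ≡ 2 (mod 3)`. -/
def M2 (k : ℕ) : SimpleGraph (Fin (3 * k + 1) ⊕ Fin (3 * k + 1)) :=
  SimpleGraph.fromRel (fun a b =>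
    match a, b with
    | Sum.inl i, Sum.inl j => (j : ℕ) = (i : ℕ) + 1 ∨ ((i : ℕ) = 3 * k ∧ (j : ℕ) = 0)
    | Sum.inr i, Sum.inr j => (j : ℕ) = (i : ℕ) + 1 ∨ ((i : ℕ) = 3 * k ∧ (j : ℕ) = 0)
    | Sum.inl i, Sum.inr j =>
        ((i : ℕ) = 0 ∧ (j : ℕ) = 0) ∨
        ((i : ℕ) = (j : ℕ) ∧ 1 ≤ (i : ℕ) ∧ (i : ℕ) ≤ 3 * k - 2 ∧ (i : ℕ) % 3 = 1) ∨
        ((j : ℕ) = (i : ℕ) + 1 ∧ 2 ≤ (i : ℕ) ∧ (i : ℕ) ≤ 3 * k - 1 ∧ (i : ℕ) % 3 = 2) ∨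
        ((i : ℕ) = (j : ℕ) + 1 ∧ 2 ≤ (j : ℕ) ∧ (j : ℕ) ≤ 3 * k - 1 ∧ (j : ℕ) % 3 = 2)
    | Sum.inr _, Sum.inl _ => False)

namespace M2aux

/-- Validity of the domination constraints for the three columns of a block. -/
def vld (x0 y0 x1 y1 x2 y2 x3 y3 x4 y4 : Bool) : Bool :=
  (x1 || x0 || x2 || y1) && (y1 || y0 || y2 || x1) && (x2 || x1 || x3 || y3) &&
    (y2 || y1 || y3 || x3) && (x3 || x2 || x4 || y2) && (y3 || y2 || y4 || x2)

/-- Number of chosen vertices in a block. -/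
def cst (x1 y1 x2 y2 x3 y3 : Bool) : ℕ :=
  x1.toNat + y1.toNat + x2.toNat + y2.toNat + x3.toNat + y3.toNat

/-- Cost of a block with prescribed middle column (9 when invalid). -/
def cc (x0 y0 x1 y1 x2 y2 x3 y3 x4 y4 : Bool) : ℕ :=
  bif vld x0 y0 x1 y1 x2 y2 x3 y3 x4 y4 then cst x1 y1 x2 y2 x3 y3 else 9

/-- Smaller of two numbers. -/
def mn (a b : ℕ) : ℕ := bif Nat.ble a b then a else b

/-- Minimal cost of a block with prescribed boundary. -/
def T0 (x0 y0 x1 y1 x3 y3 x4 y4 : Bool) : ℕ :=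
  mn (mn (cc x0 y0 x1 y1 false false x3 y3 x4 y4) (cc x0 y0 x1 y1 false true x3 y3 x4 y4))
    (mn (cc x0 y0 x1 y1 true false x3 y3 x4 y4) (cc x0 y0 x1 y1 true true x3 y3 x4 y4))

/-- Corrections to `T0` needed for an inductive invariant. -/
def cor (x0 y0 x1 y1 x3 y3 x4 y4 : Bool) : Bool :=
  (!x0 && !y0 && !x1 && !y1 && ((x3 && y3) || (x3 && y4) || (y3 && x4))) ||
    (x0 && y0 && !x1 && !y1 && !x3 && !y3)

/-- The potential function. -/
def T (x0 y0 x1 y1 x3 y3 x4 y4 : Bool) : ℕ :=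
  T0 x0 y0 x1 y1 x3 y3 x4 y4 - (cor x0 y0 x1 y1 x3 y3 x4 y4).toNat

lemma vld_of : ∀ x0 y0 x1 y1 x2 y2 x3 y3 x4 y4 : Bool,
    ((x1 = true ∨ x0 = true ∨ x2 = true ∨ y1 = true) ∧
      (y1 = true ∨ y0 = true ∨ y2 = true ∨ x1 = true)) →
    ((x2 = true ∨ x1 = true ∨ x3 = true ∨ y3 = true) ∧
      (y2 = true ∨ y1 = true ∨ y3 = true ∨ x3 = true)) →
    ((x3 = true ∨ x2 = true ∨ x4 = true ∨ y2 = true) ∧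
      (y3 = true ∨ y2 = true ∨ y4 = true ∨ x2 = true)) →
    vld x0 y0 x1 y1 x2 y2 x3 y3 x4 y4 = true := by
  intro x0 y0 x1 y1 x2 y2 x3 y3 x4 y4 g1 g2 g3
  simp only [vld, Bool.and_eq_true, Bool.or_eq_true, or_assoc]
  exact ⟨⟨⟨⟨⟨g1.1, g1.2⟩, g2.1⟩, g2.2⟩, g3.1⟩, g3.2⟩

lemma or_of : ∀ a b c d : Bool, (a = true ∨ b = true ∨ c = true ∨ d = true) →
    (a || c || b || d) = true := by
  decide

lemma T_le : ∀ x0 y0 x1 y1 x2 y2 x3 y3 x4 y4 : Bool, vld x0 y0 x1 y1 x2 y2 x3 y3 x4 y4 = true →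
    T x0 y0 x1 y1 x3 y3 x4 y4 ≤ cst x1 y1 x2 y2 x3 y3 := by
  decide +kernel

lemma T_step : ∀ a b c d x0 y0 x1 y1 x2 y2 x3 y3 x4 y4 : Bool,
    vld x0 y0 x1 y1 x2 y2 x3 y3 x4 y4 = true →
    T a b c d x3 y3 x4 y4 + 2 ≤ T a b c d x0 y0 x1 y1 + cst x1 y1 x2 y2 x3 y3 := by
  decide +kernel

lemma T_fin : ∀ a b c d x y : Bool, (a || c || x || b) = true → (b || d || y || a) = true →
    3 ≤ T a b c d x y a b + a.toNat + b.toNat := by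
  decide +kernel

attribute [irreducible] T

lemma main_bound (x y : ℕ → Bool) (k : ℕ)
    (h : ∀ j ≤ k, vld (x (3*j)) (y (3*j)) (x (3*j+1)) (y (3*j+1)) (x (3*j+2)) (y (3*j+2))
      (x (3*j+3)) (y (3*j+3)) (x (3*j+4)) (y (3*j+4)) = true) :
    2 * k + T (x 0) (y 0) (x 1) (y 1) (x (3*k+3)) (y (3*k+3)) (x (3*k+4)) (y (3*k+4)) ≤
      ∑ i ∈ Finset.range (3*k+3), ((x (i+1)).toNat + (y (i+1)).toNat) := by
  induction k with
  | zero =>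
    have := T_le _ _ _ _ _ _ _ _ _ _ (h 0 le_rfl)
    simp only [Finset.sum_range_succ, cst] at *
    simp at *
    omega
  | succ k ih =>
    have h1 := ih (fun j hj => h j (by omega))
    have h2 := T_step (x 0) (y 0) (x 1) (y 1) _ _ _ _ _ _ _ _ _ _ (h (k+1) le_rfl)
    rw [show 3 * (k+1) + 3 = 3 * k + 3 + 1 + 1 + 1 by ring, Finset.sum_range_succ,
      Finset.sum_range_succ, Finset.sum_range_succ]
    simp only [cst, show 3 * (k+1) = 3 * k + 3 by ring, add_assoc, Nat.reduceAdd] at *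
    omega

lemma adj_xx {k : ℕ} (i j : Fin (3*k+1)) : (M2 k).Adj (Sum.inl i) (Sum.inl j) ↔
    i.val ≠ j.val ∧ (j.val = i.val + 1 ∨ i.val = j.val + 1 ∨ (i.val = 3*k ∧ j.val = 0) ∨
      (j.val = 3*k ∧ i.val = 0)) := by
  simp only [M2, SimpleGraph.fromRel_adj, ne_eq, Sum.inl.injEq, Fin.ext_iff]
  tauto

lemma adj_yy {k : ℕ} (i j : Fin (3*k+1)) : (M2 k).Adj (Sum.inr i) (Sum.inr j) ↔
    i.val ≠ j.val ∧ (j.val = i.val + 1 ∨ i.val = j.val + 1 ∨ (i.val = 3*k ∧ j.val = 0) ∨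
      (j.val = 3*k ∧ i.val = 0)) := by
  simp only [M2, SimpleGraph.fromRel_adj, ne_eq, Sum.inr.injEq, Fin.ext_iff]
  tauto

lemma adj_xy {k : ℕ} (i j : Fin (3*k+1)) : (M2 k).Adj (Sum.inl i) (Sum.inr j) ↔
    (i.val = 0 ∧ j.val = 0) ∨ (i.val = j.val ∧ i.val % 3 = 1) ∨
    (j.val = i.val + 1 ∧ i.val % 3 = 2) ∨ (i.val = j.val + 1 ∧ j.val % 3 = 2) := by
  simp only [M2, SimpleGraph.fromRel_adj]
  simp
  omega

lemma adj_yx {k : ℕ} (j i : Fin (3*k+1)) : (M2 k).Adj (Sum.inr j) (Sum.inl i) ↔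
    (i.val = 0 ∧ j.val = 0) ∨ (i.val = j.val ∧ i.val % 3 = 1) ∨
    (j.val = i.val + 1 ∧ i.val % 3 = 2) ∨ (i.val = j.val + 1 ∧ j.val % 3 = 2) := by
  rw [SimpleGraph.adj_comm, adj_xy]

lemma exists_nbrs (k : ℕ) (hk : 1 ≤ k) (i : Fin (3*k+1)) :
    ∃ a b c : Fin (3*k+1), a.val ≠ b.val ∧
      (∀ j : Fin (3*k+1), (i.val ≠ j.val ∧ (j.val = i.val + 1 ∨ i.val = j.val + 1 ∨
        (i.val = 3*k ∧ j.val = 0) ∨ (j.val = 3*k ∧ i.val = 0))) ↔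
          (j.val = a.val ∨ j.val = b.val)) ∧
      (∀ j : Fin (3*k+1), ((i.val = 0 ∧ j.val = 0) ∨ (i.val = j.val ∧ i.val % 3 = 1) ∨
        (j.val = i.val + 1 ∧ i.val % 3 = 2) ∨ (i.val = j.val + 1 ∧ j.val % 3 = 2)) ↔
          j.val = c.val) := by
  refine ⟨⟨if i.val = 0 then 3*k else i.val - 1, by split <;> omega⟩,
    ⟨if i.val = 3*k then 0 else i.val + 1, by split <;> omega⟩,
    ⟨if i.val = 0 then 0 else if i.val % 3 = 1 then i.val else if i.val % 3 = 2 then i.val + 1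
      else i.val - 1, by split_ifs <;> omega⟩, ?_, ?_, ?_⟩
  · dsimp only; split_ifs <;> omega
  · intro j; dsimp only; have := j.2; have := i.2; split_ifs <;> omega
  · intro j; dsimp only; have := j.2; have := i.2; split_ifs <;> omega

lemma cubic (k : ℕ) (hk : 1 ≤ k) : IsCubic (M2 k) := by
  intro v
  rw [Nat.card_coe_set_eq, Set.ncard_eq_three]
  rcases v with i | i
  · obtain ⟨a, b, c, hab, h1, h2⟩ := exists_nbrs k hk i
    refine ⟨Sum.inl a, Sum.inl b, Sum.inr c, by simpa [Fin.ext_iff] using hab, by simp, by simp, ?_⟩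
    ext (j | j)
    · simp only [SimpleGraph.mem_neighborSet, Set.mem_insert_iff, Set.mem_singleton_iff, adj_xx,
        Sum.inl.injEq, reduceCtorEq, or_false, Fin.ext_iff]
      exact h1 j
    · simp only [SimpleGraph.mem_neighborSet, Set.mem_insert_iff, Set.mem_singleton_iff, adj_xy,
        Sum.inr.injEq, reduceCtorEq, false_or, Fin.ext_iff]
      exact h2 j
  · obtain ⟨a, b, c, hab, h1, h2⟩ := exists_nbrs k hk i
    refine ⟨Sum.inr a, Sum.inr b, Sum.inl c, by simpa [Fin.ext_iff] using hab, by simp, by simp, ?_⟩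
    ext (j | j)
    · simp only [SimpleGraph.mem_neighborSet, Set.mem_insert_iff, Set.mem_singleton_iff, adj_yx,
        Sum.inl.injEq, reduceCtorEq, false_or, Fin.ext_iff]
      rw [← h2 j]; omega
    · simp only [SimpleGraph.mem_neighborSet, Set.mem_insert_iff, Set.mem_singleton_iff, adj_yy,
        Sum.inr.injEq, reduceCtorEq, or_false, Fin.ext_iff]
      exact h1 j

/-- The Hamiltonian cycle as an enumeration of the vertices. -/
def hm (k : ℕ) (m : Fin (6*k+2)) : Fin (3*k+1) ⊕ Fin (3*k+1) :=
  if h : m.val ≤ 3*k then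
    Sum.inl ⟨if m.val = 3*k then 0 else m.val + 1, by split <;> omega⟩
  else Sum.inr ⟨if m.val = 3*k+1 then 0 else 6*k+2-m.val, by split <;> omega⟩

lemma ham (k : ℕ) (hk : 1 ≤ k) :
    ∃ (v : Fin (3 * k + 1) ⊕ Fin (3 * k + 1)) (p : (M2 k).Walk v v), p.IsHamiltonianCycle := by
  have hc : SimpleGraph.cycleGraph (6*k+2) ⊑ M2 k := by
    refine ⟨⟨⟨hm k, ?_⟩, ?_⟩⟩
    · intro u v huv
      rw [SimpleGraph.cycleGraph_adj'] at huv
      have hu := u.2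
      have hv := v.2
      have key : u.val = v.val + 1 ∨ v.val = u.val + 1 ∨ (u.val = 0 ∧ v.val = 6*k+1) ∨
          (v.val = 0 ∧ u.val = 6*k+1) := by
        simp only [Fin.sub_def] at huv
        rcases huv with h | h
        · rcases lt_or_ge (6*k+2 - v.val + u.val) (6*k+2) with h' | h'
          · rw [Nat.mod_eq_of_lt h'] at h; omega
          · rw [Nat.mod_eq_sub_mod h', Nat.mod_eq_of_lt (by omega)] at h; omega
        · rcases lt_or_ge (6*k+2 - u.val + v.val) (6*k+2) with h' | h'
          · rw [Nat.mod_eq_of_lt h'] at h; omega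
          · rw [Nat.mod_eq_sub_mod h', Nat.mod_eq_of_lt (by omega)] at h; omega
      show (M2 k).Adj (hm k u) (hm k v)
      by_cases hu3 : u.val ≤ 3*k <;> by_cases hv3 : v.val ≤ 3*k <;>
        simp only [hm, hu3, hv3, dite_true, dite_false, adj_xx, adj_xy, adj_yx, adj_yy] <;>
        split_ifs <;> omega
    · intro u v huv
      have huv : hm k u = hm k v := huv
      apply Fin.ext
      have hu := u.2
      have hv := v.2
      by_cases hu3 : u.val ≤ 3*k <;> by_cases hv3 : v.val ≤ 3*k <;>
        simp only [hm, hu3, hv3, dite_true, dite_false, Sum.inl.injEq, Sum.inr.injEq,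
          Fin.mk.injEq, reduceCtorEq] at huv <;>
        split_ifs at huv <;> omega
  rw [SimpleGraph.cycleGraph_isContained_iff (by omega)] at hc
  obtain ⟨v, p, hp, hl⟩ := hc
  refine ⟨v, p, ?_⟩
  rw [SimpleGraph.Walk.isHamiltonianCycle_iff_isCycle_and_length_eq]
  refine ⟨hp, ?_⟩
  rw [hl]; simp; ring

set_option maxHeartbeats 400000 in
lemma lower (k : ℕ) (D : Set (Fin (3*(k+1)+1) ⊕ Fin (3*(k+1)+1))) (hD : IsDomSet (M2 (k+1)) D) :
    2 * (k+1) + 1 ≤ D.ncard := by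
  classical
  let e : ℕ → Fin (3*(k+1)+1) := fun i => ⟨i % (3*(k+1)+1), Nat.mod_lt _ (by omega)⟩
  let x : ℕ → Bool := fun i => decide (Sum.inl (e i) ∈ D)
  let y : ℕ → Bool := fun i => decide (Sum.inr (e i) ∈ D)
  have he : ∀ i (hi : i < 3*(k+1)+1), e i = ⟨i, hi⟩ := fun i hi =>
    Fin.ext (Nat.mod_eq_of_lt hi)
  have hlast : e (3*k+4) = e 0 := by
    apply Fin.ext; simp [e, show 3*k+4 = 3*(k+1)+1 by ring]
  have hcard : D.ncard = ∑ i ∈ Finset.range (3*k+4), ((x i).toNat + (y i).toNat) := by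
    have h1 : D.ncard = ∑ v : Fin (3*(k+1)+1) ⊕ Fin (3*(k+1)+1), (decide (v ∈ D)).toNat := by
      rw [Set.ncard_eq_toFinset_card', ← Set.filter_mem_univ_eq_toFinset, Finset.card_filter]
      refine Finset.sum_congr rfl fun v _ => ?_
      by_cases h : v ∈ D <;> simp [h]
    rw [h1, Fintype.sum_sum_type, ← Finset.sum_add_distrib]
    rw [show 3*k+4 = 3*(k+1)+1 by ring, Finset.sum_range]
    refine Finset.sum_congr rfl fun i _ => ?_
    simp only [x, y, he i.val i.2]
  have hnx : ∀ (i : Fin (3*(k+1)+1)) (a b c : ℕ),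
      (∀ j, (M2 (k+1)).Adj j (Sum.inl i) → j = Sum.inl (e a) ∨ j = Sum.inl (e b) ∨
        j = Sum.inr (e c)) → Sum.inl i ∈ D ∨ x a = true ∨ x b = true ∨ y c = true := by
    intro i a b c h
    by_cases hi : Sum.inl i ∈ D
    · exact Or.inl hi
    · obtain ⟨u, hu, hadj⟩ := hD _ hi
      simp only [x, y, decide_eq_true_eq]
      rcases h u hadj with rfl | rfl | rfl <;> tauto
  have hny : ∀ (i : Fin (3*(k+1)+1)) (a b c : ℕ),
      (∀ j, (M2 (k+1)).Adj j (Sum.inr i) → j = Sum.inr (e a) ∨ j = Sum.inr (e b) ∨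
        j = Sum.inl (e c)) → Sum.inr i ∈ D ∨ y a = true ∨ y b = true ∨ x c = true := by
    intro i a b c h
    by_cases hi : Sum.inr i ∈ D
    · exact Or.inl hi
    · obtain ⟨u, hu, hadj⟩ := hD _ hi
      simp only [x, y, decide_eq_true_eq]
      rcases h u hadj with rfl | rfl | rfl <;> tauto
  -- the general domination constraint
  have gen : ∀ i a b c : ℕ, i < 3*(k+1)+1 → c < 3*(k+1)+1 →
      (a + 1 = i ∨ (i = 0 ∧ a = 3*(k+1))) → b = i + 1 →
      ((i = 0 ∧ c = 0) ∨ (i = c ∧ i % 3 = 1) ∨ (c = i + 1 ∧ i % 3 = 2) ∨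
        (i = c + 1 ∧ c % 3 = 2)) →
      (x i = true ∨ x a = true ∨ x b = true ∨ y c = true) ∧
      (y i = true ∨ y a = true ∨ y b = true ∨ x c = true) := by
    intro i a b c hi hc ha hb h
    have hbv : (e b).val = if i = 3*(k+1) then 0 else i + 1 := by
      subst hb
      split_ifs with h'
      · subst h'; simp [e]
      · simp only [e]; exact Nat.mod_eq_of_lt (by omega)
    have hav : (e a).val = a := by rw [he a (by omega)]
    have hcv : (e c).val = c := by rw [he c (by omega)]
    have hiv : (e i).val = i := by rw [he i hi]
    constructor
    · have := hnx (e i) a b c ?_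
      · simpa [x] using this
      · rintro (j | j) hj
        · rw [adj_xx, hiv] at hj
          have hjlt := j.2
          simp only [Sum.inl.injEq, Fin.ext_iff, hav, hbv, reduceCtorEq, or_false]
          split_ifs <;> omega
        · rw [adj_yx, hiv] at hj
          have hjlt := j.2
          simp only [Sum.inr.injEq, Fin.ext_iff, hcv, reduceCtorEq, false_or]
          omega
    · have := hny (e i) a b c ?_
      · simpa [y] using this
      · rintro (j | j) hj
        · rw [adj_xy, hiv] at hj
          have hjlt := j.2
          simp only [Sum.inl.injEq, Fin.ext_iff, hcv, reduceCtorEq, false_or]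
          omega
        · rw [adj_yy, hiv] at hj
          have hjlt := j.2
          simp only [Sum.inr.injEq, Fin.ext_iff, hav, hbv, reduceCtorEq, or_false]
          split_ifs <;> omega
  have hv := main_bound x y k (fun j hj => by
    have g1 := gen (3*j+1) (3*j) (3*j+2) (3*j+1) (by omega) (by omega) (by omega) (by omega)
      (by omega)
    have g2 := gen (3*j+2) (3*j+1) (3*j+3) (3*j+3) (by omega) (by omega) (by omega) (by omega)
      (by omega)
    have g3 := gen (3*j+3) (3*j+2) (3*j+4) (3*j+2) (by omega) (by omega) (by omega) (by omega)
      (by omega)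
    exact vld_of _ _ _ _ _ _ _ _ _ _ g1 g2 g3)
  have g0 := gen 0 (3*(k+1)) 1 0 (by omega) (by omega) (by omega) (by omega) (by omega)
  have hx : x (3*k+4) = x 0 := by simp only [x, hlast]
  have hy : y (3*k+4) = y 0 := by simp only [y, hlast]
  have hf := T_fin (x 0) (y 0) (x 1) (y 1) (x (3*k+3)) (y (3*k+3))
    (or_of _ _ _ _ g0.1) (or_of _ _ _ _ g0.2)
  rw [hx, hy] at hv
  rw [hcard, show 3*k+4 = (3*k+3)+1 by ring, Finset.sum_range_succ']
  omega

lemma upper (k : ℕ) : ∃ D : Set (Fin (3*k+1) ⊕ Fin (3*k+1)),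
    IsDomSet (M2 k) D ∧ D.ncard ≤ 2 * k + 1 := by
  classical
  let f : Fin k ⊕ Fin k ⊕ Unit → Fin (3*k+1) ⊕ Fin (3*k+1) := fun s => match s with
    | Sum.inl j => Sum.inl ⟨3 * j.val + 2, by omega⟩
    | Sum.inr (Sum.inl j) => Sum.inr ⟨3 * j.val + 2, by omega⟩
    | Sum.inr (Sum.inr _) => Sum.inl ⟨0, by omega⟩
  refine ⟨Set.range f, ?_, ?_⟩
  · rintro (i | i) hnot
    all_goals
      have hi := i.2
      have hk : i.val ≠ 0 → (i.val - 1) / 3 < k := by omega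
      by_cases h0 : i.val = 0
    · exact (hnot ⟨Sum.inr (Sum.inr ()), by simp [f, Fin.ext_iff, h0]⟩).elim
    · refine ⟨_, ⟨Sum.inl ⟨(i.val - 1) / 3, by omega⟩, rfl⟩, ?_⟩
      by_cases h2 : i.val % 3 = 2
      · exact (hnot ⟨Sum.inl ⟨(i.val - 1) / 3, by omega⟩, by simp [f, Fin.ext_iff]; omega⟩).elim
      · simp only [f, adj_xx]; omega
    · refine ⟨_, ⟨Sum.inr (Sum.inr ()), rfl⟩, ?_⟩
      exact (adj_xy _ _).2 (Or.inl ⟨rfl, h0⟩)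
    · refine ⟨_, ⟨Sum.inr (Sum.inl ⟨(i.val - 1) / 3, by omega⟩), rfl⟩, ?_⟩
      by_cases h2 : i.val % 3 = 2
      · exact (hnot ⟨Sum.inr (Sum.inl ⟨(i.val - 1) / 3, by omega⟩),
          by simp [f, Fin.ext_iff]; omega⟩).elim
      · simp only [f, adj_yy]; omega
  · rw [← Set.image_univ]
    refine (Set.ncard_image_le).trans ?_
    rw [Set.ncard_univ]; simp; omega

end M2aux

/-- For every `k ≥ 1`, the graph `M²_k` is a cubic graph with `6k + 2`
vertices, it has a Hamiltonian cycle, and `γ(M²_k) = 2k + 1 = ⌈(6k+2)/3⌉`. -/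
theorem stmt_17 (k : ℕ) (hk : 1 ≤ k) :
    IsCubic (M2 k) ∧
    Fintype.card (Fin (3 * k + 1) ⊕ Fin (3 * k + 1)) = 6 * k + 2 ∧
    (∃ (v : Fin (3 * k + 1) ⊕ Fin (3 * k + 1)) (p : (M2 k).Walk v v),
      p.IsHamiltonianCycle) ∧
    domNum (M2 k) = 2 * k + 1 ∧
    2 * k + 1 = ⌈(6 * k + 2 : ℚ) / 3⌉₊ := by
  refine ⟨M2aux.cubic k hk, by simp; ring, M2aux.ham k hk, ?_, ?_⟩

  · obtain ⟨k, rfl⟩ : ∃ m, k = m + 1 := ⟨k - 1, by omega⟩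
    obtain ⟨D, hD, hc⟩ := M2aux.upper (k+1)
    have hl := M2aux.lower k D hD
    apply le_antisymm
    · exact Nat.sInf_le ⟨D, hD, by omega⟩
    · have hne : {n : ℕ | ∃ D, IsDomSet (M2 (k+1)) D ∧ D.ncard = n}.Nonempty :=
        ⟨D.ncard, D, hD, rfl⟩
      refine le_csInf hne ?_
      rintro n ⟨E, hE, rfl⟩
      exact M2aux.lower k E hE
  · symm
    rw [Nat.ceil_eq_iff (by omega)]
    constructor
    · simp only [Nat.add_sub_cancel]
      push_cast
      linarith
    · push_cast
      linarith
end

section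
/- Let M⁰_k be obtained from M²_k by deleting the vertices x_0 and y_0 and adding the edges x_1 x_{3k} and y_1 y_{3k}, and let M¹_k be obtained from M²_k by deleting the vertices x_0, y_0, x_1, y_1 and adding the edges x_2 x_{3k} and y_2 y_{3k}. Then for every integer k ≥ 1, M⁰_k is a cubic graph with 6k vertices having a Hamiltonian cycle and γ(M⁰_k) = 2k = ⌈6k/3⌉, and for every integer k ≥ 2, M¹_k is a cubic graph with 6k − 2 vertices having a Hamiltonian cycle and γ(M¹_k) = 2k − 1 = ⌊(6k−2)/3⌋. -/
open SimpleGraph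

/-- The graph `M⁰_k`, obtained from `M²_k` by deleting the vertices `x_0`, `y_0` and adding
the edges `x_1 x_{3k}` and `y_1 y_{3k}`. -/
def M0 (k : ℕ) :
    SimpleGraph {v : Fin (3 * k + 1) ⊕ Fin (3 * k + 1) //
      v ≠ Sum.inl ⟨0, by omega⟩ ∧ v ≠ Sum.inr ⟨0, by omega⟩} :=
  SimpleGraph.fromRel (fun a b =>
    (M2 k).Adj a.val b.val ∨
    (∃ i j : Fin (3 * k + 1), (i : ℕ) = 1 ∧ (j : ℕ) = 3 * k ∧
      a.val = Sum.inl i ∧ b.val = Sum.inl j) ∨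
    (∃ i j : Fin (3 * k + 1), (i : ℕ) = 1 ∧ (j : ℕ) = 3 * k ∧
      a.val = Sum.inr i ∧ b.val = Sum.inr j))

/-- The graph `M¹_k`, obtained from `M²_k` by deleting the vertices `x_0`, `y_0`, `x_1`, `y_1`
and adding the edges `x_2 x_{3k}` and `y_2 y_{3k}`. -/
def M1 (k : ℕ) :
    SimpleGraph {v : Fin (3 * k + 1) ⊕ Fin (3 * k + 1) //
      (∀ i : Fin (3 * k + 1), (i : ℕ) = 0 ∨ (i : ℕ) = 1 →
        v ≠ Sum.inl i ∧ v ≠ Sum.inr i)} :=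
  SimpleGraph.fromRel (fun a b =>
    (M2 k).Adj a.val b.val ∨
    (∃ i j : Fin (3 * k + 1), (i : ℕ) = 2 ∧ (j : ℕ) = 3 * k ∧
      a.val = Sum.inl i ∧ b.val = Sum.inl j) ∨
    (∃ i j : Fin (3 * k + 1), (i : ℕ) = 2 ∧ (j : ℕ) = 3 * k ∧
      a.val = Sum.inr i ∧ b.val = Sum.inr j))

/-- Adjacency in the family, written on codes `(row, index)`. -/
def CodeAdj (k s : ℕ) (p q : Bool × ℕ) : Prop :=
  (p.1 = q.1 ∧ (q.2 = p.2 + 1 ∨ p.2 = q.2 + 1 ∨ (p.2 = s ∧ q.2 = 3 * k) ∨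
    (p.2 = 3 * k ∧ q.2 = s))) ∨
  (p.1 ≠ q.1 ∧ ((p.2 = q.2 ∧ p.2 % 3 = 1) ∨ (q.2 = p.2 + 1 ∧ p.2 % 3 = 2) ∨
    (p.2 = q.2 + 1 ∧ q.2 % 3 = 2)))

/-- `f` identifies `G` with the coded graph on indices `s, …, 3k`. -/
structure Coding {V : Type*} (G : SimpleGraph V) (k s : ℕ) (f : V → Bool × ℕ) : Prop where
  inj : Function.Injective f
  mem : ∀ v, s ≤ (f v).2 ∧ (f v).2 ≤ 3 * k
  surj : ∀ b i, s ≤ i → i ≤ 3 * k → ∃ v, f v = (b, i)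
  adj : ∀ u v, G.Adj u v ↔ CodeAdj k s (f u) (f v)

namespace Coding

variable {V : Type*} {G : SimpleGraph V} {k s : ℕ} {f : V → Bool × ℕ}

lemma range_eq (h : Coding G k s f) :
    f '' Set.univ = ((Finset.univ ×ˢ Finset.Icc s (3 * k) : Finset (Bool × ℕ)) : Set (Bool × ℕ)) := by
  ext ⟨b, i⟩
  simp only [Set.image_univ, Set.mem_range, Finset.coe_product, Finset.coe_univ, Set.mem_prod,
    Set.mem_univ, true_and, Finset.coe_Icc, Set.mem_Icc]
  constructor
  · rintro ⟨v, hv⟩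
    have := h.mem v
    rw [hv] at this
    exact this
  · rintro ⟨h1, h2⟩
    exact h.surj b i h1 h2

lemma card_eq (h : Coding G k s f) : Nat.card V = 2 * (3 * k + 1 - s) := by
  rw [← Set.ncard_univ, ← Set.ncard_image_of_injective _ h.inj, h.range_eq, Set.ncard_coe_finset]
  simp

lemma finite (h : Coding G k s f) : Finite V := by
  have : (f '' Set.univ).Finite := by rw [h.range_eq]; exact Finset.finite_toSet _
  exact Set.finite_univ_iff.1 (this.of_finite_image h.inj.injOn)

lemma cubic (h : Coding G k s f) (hk : s + 2 ≤ 3 * k) (hs : s = 1 ∨ s = 2) : IsCubic G := by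
  intro v
  have e : Nat.card (G.neighborSet v) = (f '' G.neighborSet v).ncard := by
    rw [Set.ncard_image_of_injective _ h.inj]; rfl
  have e2 : f '' G.neighborSet v = {q | (s ≤ q.2 ∧ q.2 ≤ 3 * k) ∧ CodeAdj k s (f v) q} := by
    ext ⟨b, i⟩
    simp only [Set.mem_image, mem_neighborSet, Set.mem_ofPred_eq]
    constructor
    · rintro ⟨u, hu, e⟩
      have h1 := h.mem u
      have h2 := (h.adj _ _).1 hu
      rw [e] at h1 h2
      exact ⟨h1, h2⟩
    · rintro ⟨⟨h1, h2⟩, h3⟩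
      obtain ⟨u, hu⟩ := h.surj b i h1 h2
      refine ⟨u, ?_, hu⟩
      rw [h.adj, hu]; exact h3
  rw [e, e2, Set.ncard_eq_three]
  have hm := h.mem v
  generalize f v = q at hm ⊢
  obtain ⟨b, i⟩ := q
  simp only at hm
  refine ⟨(b, if i = 3 * k then s else i + 1), (b, if i = s then 3 * k else i - 1),
    (!b, if i % 3 = 1 then i else if i % 3 = 2 then i + 1 else i - 1), ?_, ?_, ?_, ?_⟩
  · simp only [ne_eq, Prod.mk.injEq, true_and]
    split_ifs <;> omega
  · simp
  · simp
  · ext ⟨c, j⟩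
    simp only [Set.mem_ofPred_eq, CodeAdj, Set.mem_insert_iff, Set.mem_singleton_iff,
      Prod.mk.injEq]
    rcases Bool.eq_or_eq_not c b with rfl | rfl
    · simp only [true_and, ne_eq, not_true_eq_false, false_and, or_false]
      have : (c = !c) = False := by simp
      rw [this]
      simp only [false_and, or_false]
      split_ifs <;> omega
    · have h1 : (b = !b) = False := by simp
      have h2 : ((!b) = b) = False := by simp
      simp only [h1, h2, ne_eq, false_and, false_or, not_false_eq_true, true_and]
      split_ifs <;> omega

/-- The code of the `t`-th vertex on the Hamiltonian cycle. -/
def hamCode (k s t : ℕ) : Bool × ℕ :=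
  if t < 3 * k - s then (false, s + t)
  else if t = 3 * k - s then (true, 3 * k)
  else if t < 2 * (3 * k - s) + 1 then (true, t - (3 * k - s) - 1 + s)
  else (false, 3 * k)

lemma ham [DecidableEq V] (h : Coding G k s f) (hk : s + 2 ≤ 3 * k) :
    ∃ (v : V) (p : G.Walk v v), p.IsHamiltonianCycle := by
  have := h.finite
  have : Fintype V := Fintype.ofFinite V
  obtain ⟨n, hn⟩ : ∃ n, n + 3 = 2 * (3 * k + 1 - s) := ⟨2 * (3 * k + 1 - s) - 3, by omega⟩
  have hcard : Fintype.card V = n + 3 := by rw [← Nat.card_eq_fintype_card, h.card_eq, hn]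
  have hex : ∀ t : Fin (n + 3), ∃ v, f v = hamCode k s t := by
    intro t
    have := t.2
    unfold hamCode
    split_ifs <;> apply h.surj <;> omega
  choose g hg using hex
  have hstep : ∀ a b : Fin (n + 3), (a - b = 1) → CodeAdj k s (hamCode k s a) (hamCode k s b) ∧
      CodeAdj k s (hamCode k s b) (hamCode k s a) := by
    intro a b hab
    have hab' : a = b + 1 := by rw [← hab]; abel
    have ha := a.2
    have hb := b.2
    have : (a : ℕ) = if (b : ℕ) = n + 2 then 0 else (b : ℕ) + 1 := by
      rw [hab', Fin.val_add_one]
      simp [Fin.ext_iff, -Fin.val_eq_zero_iff]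
    generalize (a : ℕ) = a' at *
    generalize (b : ℕ) = b' at *
    subst this
    unfold hamCode CodeAdj
    split_ifs <;> simp <;> omega
  let φ : cycleGraph (n + 3) →g G := ⟨g, by
    intro a b hab
    rw [cycleGraph_adj] at hab
    rw [h.adj, hg, hg]
    rcases hab with hab | hab
    · exact (hstep a b hab).1
    · exact (hstep b a hab).2⟩
  have hinj : Function.Injective φ := by
    intro a b hab
    have e : hamCode k s a = hamCode k s b := by rw [← hg, ← hg]; exact congrArg f hab
    have ha := a.2
    have hb := b.2
    ext
    generalize (a : ℕ) = a' at *
    generalize (b : ℕ) = b' at *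
    unfold hamCode at e
    split_ifs at e <;> simp at e <;> omega
  refine ⟨φ 0, (cycleGraph.cycle n).map φ, ?_⟩
  rw [Walk.isHamiltonianCycle_iff_isCycle_and_length_eq]
  refine ⟨cycleGraph.isCycle_cycle.map hinj, ?_⟩
  rw [Walk.length_map, cycleGraph.length_cycle, hcard]

open Classical in
/-- Indicator of a set on codes. -/
noncomputable def ind (f : V → Bool × ℕ) (D : Set V) (b : Bool) (i : ℕ) : ℕ :=
  if (b, i) ∈ f '' D then 1 else 0

lemma ind_le (D : Set V) (b : Bool) (i : ℕ) : ind f D b i ≤ 1 := by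
  unfold ind; split_ifs <;> simp

lemma ncard_eq (h : Coding G k s f) (D : Set V) :
    D.ncard = ∑ i ∈ Finset.range (3 * k + 1), (ind f D false i + ind f D true i) := by
  classical
  have e : f '' D = (((Finset.range (3 * k + 1)) ×ˢ (Finset.univ : Finset Bool)).image Prod.swap).filter
      (fun p => p ∈ f '' D) := by
    ext ⟨b, i⟩
    simp only [Finset.coe_filter, Finset.mem_image, Finset.mem_product, Finset.mem_range,
      Finset.mem_univ, and_true, Set.mem_ofPred_eq]
    constructor
    · intro hx
      refine ⟨⟨(i, b), ?_, rfl⟩, hx⟩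
      obtain ⟨v, _, hv⟩ := hx
      have := h.mem v
      rw [hv] at this
      simp only at this ⊢
      omega
    · exact fun hx => hx.2
  rw [← Set.ncard_image_of_injective D h.inj, e, Set.ncard_coe_finset, Finset.card_filter,
    Finset.sum_image (Prod.swap_injective.injOn), Finset.sum_product]
  apply Finset.sum_congr rfl
  intro i _
  rw [Fintype.sum_bool, add_comm]
  simp only [ind, Prod.swap]

/-- Domination of one vertex, on indicators. -/
lemma dom (h : Coding G k s f) {D : Set V} (hD : IsDomSet G D) (b : Bool) (i : ℕ)
    (h1 : s ≤ i) (h2 : i ≤ 3 * k) :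
    ∃ c j, s ≤ j ∧ j ≤ 3 * k ∧ ind f D c j = 1 ∧ ((c = b ∧ j = i) ∨ CodeAdj k s (c, j) (b, i)) := by
  obtain ⟨v, hv⟩ := h.surj b i h1 h2
  by_cases hvD : v ∈ D
  · exact ⟨b, i, h1, h2, by rw [ind, if_pos ⟨v, hvD, hv⟩], Or.inl ⟨rfl, rfl⟩⟩
  · obtain ⟨u, hu, ha⟩ := hD v hvD
    refine ⟨(f u).1, (f u).2, (h.mem u).1, (h.mem u).2, by rw [ind, if_pos ⟨u, hu, rfl⟩],
      Or.inr ?_⟩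
    rw [← hv, ← h.adj]
    exact ha

lemma dom_first (h : Coding G k s f) {D : Set V} (hD : IsDomSet G D) (b : Bool) (i : ℕ)
    (h1 : s ≤ i) (h2 : i ≤ 3 * k) (hi : i % 3 = 1) :
    1 ≤ ind f D b (if i = s then 3 * k else i - 1) + ind f D b i + ind f D b (i + 1) +
      ind f D (!b) i := by
  obtain ⟨c, j, h3, h4, h5, h6⟩ := h.dom hD b i h1 h2
  rcases Bool.eq_or_eq_not c b with rfl | rfl
  · have : j = i ∨ j = i + 1 ∨ j = (if i = s then 3 * k else i - 1) := by
      simp [CodeAdj] at h6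
      split_ifs <;> omega
    rcases this with rfl | rfl | rfl <;> omega
  · have : j = i := by
      simp [CodeAdj] at h6
      omega
    subst this; omega

lemma dom_second (h : Coding G k s f) {D : Set V} (hD : IsDomSet G D) (b : Bool) (i : ℕ)
    (h1 : s ≤ i) (h2 : i ≤ 3 * k) (hi : i % 3 = 2) :
    1 ≤ ind f D b (if i = s then 3 * k else i - 1) + ind f D b i + ind f D b (i + 1) +
      ind f D (!b) (i + 1) := by
  obtain ⟨c, j, h3, h4, h5, h6⟩ := h.dom hD b i h1 h2
  rcases Bool.eq_or_eq_not c b with rfl | rfl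
  · have : j = i ∨ j = i + 1 ∨ j = (if i = s then 3 * k else i - 1) := by
      simp [CodeAdj] at h6
      split_ifs <;> omega
    rcases this with rfl | rfl | rfl <;> omega
  · have : j = i + 1 := by
      simp [CodeAdj] at h6
      omega
    subst this; omega

lemma lower (h : Coding G k s f) (hk : s + 2 ≤ 3 * k) (hs : s = 1 ∨ s = 2) {D : Set V}
    (hD : IsDomSet G D) : 2 * k + 1 - s ≤ D.ncard := by
  have key : ∀ j, j + 1 ≤ k → 2 * (j + 1) + 1 - s +
      min (ind f D false (3 * j + 3)) (ind f D true (3 * j + 3)) ≤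
      (∑ i ∈ Finset.range (3 * j + 4), (ind f D false i + ind f D true i)) +
      min (ind f D false (3 * k)) (ind f D true (3 * k)) := by
    intro j
    induction j with
    | zero =>
      intro hj
      simp only [Finset.sum_range_succ, Finset.sum_range_zero, Nat.mul_zero, Nat.zero_add]
      have l := ind_le (f := f) D
      have l1 := l false 3
      have l2 := l true 3
      have l3 := l false (3 * k)
      have l4 := l true (3 * k)
      rcases hs with rfl | rfl
      · have a1 := h.dom_first hD false 1 (by omega) (by omega) (by omega)
        have a2 := h.dom_first hD true 1 (by omega) (by omega) (by omega)
        have a3 := h.dom_second hD false 2 (by omega) (by omega) (by omega)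
        have a4 := h.dom_second hD true 2 (by omega) (by omega) (by omega)
        simp at a1 a2 a3 a4
        omega
      · have a3 := h.dom_second hD false 2 (by omega) (by omega) (by omega)
        have a4 := h.dom_second hD true 2 (by omega) (by omega) (by omega)
        simp at a3 a4
        omega
    | succ j ih =>
      intro hj
      have ih := ih (by omega)
      have l := ind_le (f := f) D
      have l1 := l false (3 * j + 3)
      have l2 := l true (3 * j + 3)
      have l3 := l false (3 * j + 6)
      have l4 := l true (3 * j + 6)
      have a1 := h.dom_first hD false (3 * j + 4) (by omega) (by omega) (by omega)
      have a2 := h.dom_first hD true (3 * j + 4) (by omega) (by omega) (by omega)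
      have a3 := h.dom_second hD false (3 * j + 5) (by omega) (by omega) (by omega)
      have a4 := h.dom_second hD true (3 * j + 5) (by omega) (by omega) (by omega)
      rw [if_neg (by omega)] at a1 a2 a3 a4
      simp only [Bool.not_false, Bool.not_true] at a1 a2 a3 a4
      have e1 : 3 * j + 4 - 1 = 3 * j + 3 := by omega
      have e2 : 3 * j + 5 - 1 = 3 * j + 4 := by omega
      rw [e1] at a1 a2
      rw [e2] at a3 a4
      have e3 : 3 * (j + 1) + 4 = 3 * j + 4 + 1 + 1 + 1 := by ring
      have e4 : 3 * (j + 1) + 3 = 3 * j + 6 := by ring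
      rw [e3, e4]
      simp only [Finset.sum_range_succ _ (3 * j + 4), Finset.sum_range_succ _ (3 * j + 4 + 1),
        Finset.sum_range_succ _ (3 * j + 4 + 1 + 1)]
      simp only [Nat.add_assoc, Nat.reduceAdd] at *
      omega
  rw [h.ncard_eq]
  have := key (k - 1) (by omega)
  have e1 : 3 * (k - 1) + 3 = 3 * k := by omega
  have e2 : 3 * (k - 1) + 4 = 3 * k + 1 := by omega
  rw [e1, e2] at this
  omega

/-- The optimal dominating set. -/
def optCode (s : ℕ) (p : Bool × ℕ) : Prop :=
  (p.1 = false ∧ p.2 % 3 = 1) ∨ (p.1 = true ∧ p.2 % 3 = 0 ∧ s + 2 ≤ p.2) ∨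
    (s = 2 ∧ p.1 = false ∧ p.2 = 2)

lemma opt_dom (h : Coding G k s f) (hk : s + 2 ≤ 3 * k) (hs : s = 1 ∨ s = 2) :
    IsDomSet G {v | optCode s (f v)} := by
  intro v hv
  have hm := h.mem v
  suffices H : ∃ c j, s ≤ j ∧ j ≤ 3 * k ∧ optCode s (c, j) ∧ CodeAdj k s (c, j) (f v) by
    obtain ⟨c, j, h1, h2, h3, h4⟩ := H
    obtain ⟨u, hu⟩ := h.surj c j h1 h2
    refine ⟨u, ?_, ?_⟩
    · simpa [hu] using h3
    · rw [h.adj, hu]; exact h4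
  simp only [Set.mem_ofPred_eq] at hv
  generalize f v = q at hm hv ⊢
  obtain ⟨b, i⟩ := q
  simp only [optCode, CodeAdj] at *
  have : i % 3 = 0 ∨ i % 3 = 1 ∨ i % 3 = 2 := by omega
  cases b
  · rcases this with hi | hi | hi
    · by_cases h3 : i = 3 * k
      · exact ⟨false, s, by simp; omega⟩
      · exact ⟨false, i + 1, by simp; omega⟩
    · simp at hv; omega
    · exact ⟨true, i + 1, by simp at *; omega⟩
  · rcases this with hi | hi | hi
    · exact ⟨false, 2, by simp at *; omega⟩
    · exact ⟨false, i, by simp; omega⟩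
    · by_cases h3 : i = s
      · exact ⟨true, 3 * k, by simp at *; omega⟩
      · exact ⟨true, i + 1, by simp at *; omega⟩

lemma opt_card (h : Coding G k s f) (hk : s + 2 ≤ 3 * k) (hs : s = 1 ∨ s = 2) :
    {v | optCode s (f v)}.ncard ≤ 2 * k + 1 - s := by
  classical
  have hind : ∀ b i, ind f {v | optCode s (f v)} b i =
      if s ≤ i ∧ i ≤ 3 * k ∧ optCode s (b, i) then 1 else 0 := by
    intro b i
    unfold ind
    congr 1
    simp only [Set.mem_image, Set.mem_ofPred_eq, eq_iff_iff]
    constructor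
    · rintro ⟨v, h1, h2⟩
      have := h.mem v
      rw [h2] at this h1
      exact ⟨this.1, this.2, h1⟩
    · rintro ⟨h1, h2, h3⟩
      obtain ⟨v, hv⟩ := h.surj b i h1 h2
      exact ⟨v, by rwa [hv], hv⟩
  have key : ∀ j, j + 1 ≤ k →
      (∑ i ∈ Finset.range (3 * j + 4), (ind f {v | optCode s (f v)} false i +
        ind f {v | optCode s (f v)} true i)) ≤ 2 * (j + 1) + 1 - s := by
    intro j
    induction j with
    | zero =>
      intro hj
      simp only [hind, Finset.sum_range_succ, Finset.sum_range_zero, Nat.mul_zero,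
        Nat.zero_add]
      simp only [optCode]
      rcases hs with rfl | rfl <;> simp <;> split_ifs <;> omega
    | succ j ih =>
      intro hj
      have ih := ih (by omega)
      have e3 : 3 * (j + 1) + 4 = 3 * j + 4 + 1 + 1 + 1 := by ring
      rw [e3]
      simp only [Finset.sum_range_succ _ (3 * j + 4), Finset.sum_range_succ _ (3 * j + 4 + 1),
        Finset.sum_range_succ _ (3 * j + 4 + 1 + 1)]
      have b1 : ind f {v | optCode s (f v)} true (3 * j + 4) = 0 := by
        rw [hind, if_neg]; simp [optCode] <;> omega
      have b2 : ind f {v | optCode s (f v)} true (3 * j + 4 + 1) = 0 := by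
        rw [hind, if_neg]; simp [optCode] <;> omega
      have b3 : ind f {v | optCode s (f v)} false (3 * j + 4 + 1) = 0 := by
        rw [hind, if_neg]; simp [optCode] <;> omega
      have b4 : ind f {v | optCode s (f v)} false (3 * j + 4 + 1 + 1) = 0 := by
        rw [hind, if_neg]; simp [optCode] <;> omega
      have l1 := ind_le (f := f) {v | optCode s (f v)} false (3 * j + 4)
      have l2 := ind_le (f := f) {v | optCode s (f v)} true (3 * j + 4 + 1 + 1)
      omega
  rw [h.ncard_eq]
  have := key (k - 1) (by omega)
  have e2 : 3 * (k - 1) + 4 = 3 * k + 1 := by omega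
  rw [e2] at this
  omega

lemma domNum_eq (h : Coding G k s f) (hk : s + 2 ≤ 3 * k) (hs : s = 1 ∨ s = 2) :
    domNum G = 2 * k + 1 - s := by
  unfold domNum
  apply le_antisymm
  · refine le_trans (Nat.sInf_le (m := {v | optCode s (f v)}.ncard) ?_) (h.opt_card hk hs)
    exact ⟨_, h.opt_dom hk hs, rfl⟩
  · refine le_csInf ⟨{v | optCode s (f v)}.ncard, ?_⟩ ?_
    · exact ⟨_, h.opt_dom hk hs, rfl⟩
    rintro n ⟨D, hD, rfl⟩
    exact h.lower hk hs hD

end Coding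

/-- Code of a vertex of `M2 k`. -/
def code (k : ℕ) : Fin (3 * k + 1) ⊕ Fin (3 * k + 1) → Bool × ℕ
  | Sum.inl i => (false, i)
  | Sum.inr i => (true, i)

lemma code_injective (k : ℕ) : Function.Injective (code k) := by
  rintro (i | i) (j | j) h <;> simp [code, Fin.ext_iff, -Fin.val_eq_zero_iff] at h ⊢ <;> exact h

lemma fin_aux (k c : ℕ) (hc : c ≤ 3 * k) (a b : ℕ) :
    (∃ i : Fin (3 * k + 1), (i : ℕ) = c ∧ ∃ x : Fin (3 * k + 1), (x : ℕ) = 3 * k ∧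
      a = i ∧ b = x) ↔ a = c ∧ b = 3 * k := by
  constructor
  · rintro ⟨i, h1, x, h2, h3, h4⟩
    omega
  · rintro ⟨h1, h2⟩
    exact ⟨⟨c, by omega⟩, rfl, ⟨3 * k, by omega⟩, rfl, h1, h2⟩

lemma M0_coding (k : ℕ) (hk : 1 ≤ k) : Coding (M0 k) k 1 (fun v => code k v.val) where
  inj := fun a b h => Subtype.ext (code_injective k h)
  mem := by
    rintro ⟨(i | i), h⟩ <;> simp [code, Fin.ext_iff, -Fin.val_eq_zero_iff] at h ⊢ <;> omega
  surj := by
    intro b i h1 h2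
    cases b
    · exact ⟨⟨Sum.inl ⟨i, by omega⟩, by simp; omega⟩, rfl⟩
    · exact ⟨⟨Sum.inr ⟨i, by omega⟩, by simp; omega⟩, rfl⟩
  adj := by
    have H := fin_aux k 1 (by omega)
    rintro ⟨(i | i), hi⟩ ⟨(j | j), hj⟩ <;> simp [Fin.ext_iff, -Fin.val_eq_zero_iff] at hi hj <;>
      have := i.2 <;> have := j.2 <;>
      simp [M0, M2, code, CodeAdj, Fin.ext_iff, -Fin.val_eq_zero_iff]
    all_goals try simp only [H, Subtype.ext_iff, Sum.inl.injEq, Sum.inr.injEq, Fin.ext_iff,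
      reduceCtorEq, not_false_eq_true, true_and]
    all_goals omega

lemma M1_coding (k : ℕ) (hk : 2 ≤ k) : Coding (M1 k) k 2 (fun v => code k v.val) where
  inj := fun a b h => Subtype.ext (code_injective k h)
  mem := by
    rintro ⟨(i | i), h⟩ <;> have h := h i <;> simp [code, Fin.ext_iff, -Fin.val_eq_zero_iff] at h ⊢ <;> omega
  surj := by
    intro b i h1 h2
    cases b
    · exact ⟨⟨Sum.inl ⟨i, by omega⟩, by simp [Fin.ext_iff, -Fin.val_eq_zero_iff]; omega⟩, rfl⟩
    · exact ⟨⟨Sum.inr ⟨i, by omega⟩, by simp [Fin.ext_iff, -Fin.val_eq_zero_iff]; omega⟩, rfl⟩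
  adj := by
    have H := fin_aux k 2 (by omega)
    rintro ⟨(i | i), hi⟩ ⟨(j | j), hj⟩ <;> have hi' := hi i <;> have hj' := hj j <;>
      simp [-Fin.val_eq_zero_iff] at hi' hj' <;>
      have := i.2 <;> have := j.2 <;>
      simp [M1, M2, code, CodeAdj, Fin.ext_iff, -Fin.val_eq_zero_iff]
    all_goals try simp only [H, Subtype.ext_iff, Sum.inl.injEq, Sum.inr.injEq, Fin.ext_iff,
      reduceCtorEq, not_false_eq_true, true_and]
    all_goals omega

/-- For every `k ≥ 1`, `M⁰_k` is a cubic graph with `6k` vertices having a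
Hamiltonian cycle and `γ(M⁰_k) = 2k = ⌈6k/3⌉`; for every `k ≥ 2`, `M¹_k` is a cubic graph with
`6k − 2` vertices having a Hamiltonian cycle and `γ(M¹_k) = 2k − 1 = ⌊(6k−2)/3⌋`. -/
theorem stmt_18 :
    (∀ k : ℕ, 1 ≤ k →
      IsCubic (M0 k) ∧
      Nat.card {v : Fin (3 * k + 1) ⊕ Fin (3 * k + 1) //
        v ≠ Sum.inl ⟨0, by omega⟩ ∧ v ≠ Sum.inr ⟨0, by omega⟩} = 6 * k ∧
      (∃ (v : _) (p : (M0 k).Walk v v), p.IsHamiltonianCycle) ∧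
      domNum (M0 k) = 2 * k ∧
      2 * k = ⌈(6 * k : ℚ) / 3⌉₊) ∧
    (∀ k : ℕ, 2 ≤ k →
      IsCubic (M1 k) ∧
      Nat.card {v : Fin (3 * k + 1) ⊕ Fin (3 * k + 1) //
        (∀ i : Fin (3 * k + 1), (i : ℕ) = 0 ∨ (i : ℕ) = 1 →
          v ≠ Sum.inl i ∧ v ≠ Sum.inr i)} = 6 * k - 2 ∧
      (∃ (v : _) (p : (M1 k).Walk v v), p.IsHamiltonianCycle) ∧
      domNum (M1 k) = 2 * k - 1 ∧
      2 * k - 1 = ⌊(6 * k - 2 : ℚ) / 3⌋₊) := by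
  refine ⟨fun k hk => ?_, fun k hk => ?_⟩
  · have h := M0_coding k hk
    refine ⟨h.cubic (by omega) (by omega), ?_, h.ham (by omega), ?_, ?_⟩
    · rw [h.card_eq]; omega
    · rw [h.domNum_eq (by omega) (by omega)]; omega
    · have e : (6 * k : ℚ) / 3 = ((2 * k : ℕ) : ℚ) := by push_cast; ring
      rw [e, Nat.ceil_natCast]
  · have h := M1_coding k hk
    refine ⟨h.cubic (by omega) (by omega), ?_, h.ham (by omega), ?_, ?_⟩
    · rw [h.card_eq]; omega
    · rw [h.domNum_eq (by omega) (by omega)]; omega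
    · symm
      have hk' : (2 : ℚ) ≤ k := by exact_mod_cast hk
      rw [Nat.floor_eq_iff (by linarith), Nat.cast_sub (by omega)]
      push_cast
      constructor <;> linarith
end
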